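/- arXiv:1306.6580 — 3 statements merged into one kernel-verified Lean document; each statement's English description precedes it below -/
import Mathlib

section
/- Let A be a commutative ℚ-algebra, let F ∈ A[y] be a polynomial in one variable y, and let c be a nonnegative integer. If for every integer d > c the coefficient of y^d in the polynomial (1+4y)^d·F vanishes, then F = 0. -/
/-- A linear combination of the functions `d ↦ d.choose k`, `k < n`, that vanishes for all large `d`
has zero coefficients. -/
theorem eq_zero_of_forall_sum_choose_smul_eq_zero {M : Type*} [AddCommGroup M] (c n : ℕ)
    (g : ℕ → M) (h : ∀ d, c < d → ∑ k ∈ Finset.range n, d.choose k • g k = 0) :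
    ∀ k < n, g k = 0 := by
  induction n generalizing g with
  | zero => simp
  | succ n ih =>
    have hs : ∀ k < n, g (k + 1) = 0 := by
      refine ih (fun k => g (k + 1)) fun d hd => ?_
      have h₁ := h (d + 1) (by lia)
      have h₀ := h d hd
      rw [Finset.sum_range_succ'] at h₀ h₁
      simp only [Nat.choose_succ_succ', add_smul, Finset.sum_add_distrib,
        Nat.choose_zero_right] at h₀ h₁
      rwa [add_assoc, h₀, add_zero] at h₁
    have h₀ := h (c + 1) (by lia)
    rw [Finset.sum_range_succ', Finset.sum_eq_zero fun k hk => by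
      rw [hs k (Finset.mem_range.1 hk), smul_zero]] at h₀
    rintro (_ | k) hk
    · simpa using h₀
    · exact hs k (by lia)

namespace Polynomial

theorem coeff_one_add_C_mul_X_pow {R : Type*} [CommSemiring R] (u : R) (d m : ℕ) :
    ((1 + C u * X) ^ d).coeff m = d.choose m * u ^ m := by
  have : (1 + C u * X) ^ d = ((1 + X : R[X]) ^ d).comp (C u * X) := by simp
  rw [this, comp_C_mul_X_coeff, coeff_one_add_X_pow]

theorem coeff_one_add_C_unit_mul_X_pow_mul {R : Type*} [CommRing R] (u : Rˣ) (F : R[X]) (d : ℕ) :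
    ((1 + C (u : R) * X) ^ d * F).coeff d =
      u ^ d * ∑ k ∈ Finset.range (F.natDegree + 1),
        d.choose k • ((↑u⁻¹ : R) ^ k * F.coeff k) := by
  conv_lhs => rw [F.as_sum_range_C_mul_X_pow]
  simp only [Finset.mul_sum, finsetSum_coeff, ← mul_assoc, coeff_mul_X_pow', coeff_mul_C,
    coeff_one_add_C_mul_X_pow]
  refine Finset.sum_congr rfl fun k _ => ?_
  split_ifs with hk
  · have hu : (u : R) ^ d * (↑u⁻¹ : R) ^ k = (u : R) ^ (d - k) := by
      rw [← Nat.sub_add_cancel hk, pow_add, mul_assoc, ← mul_pow]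
      simp
    rw [Nat.choose_symm hk, nsmul_eq_mul, ← hu]
    ring
  · simp [Nat.choose_eq_zero_of_lt (not_le.1 hk)]

/-- If the diagonal coefficients `[y^d] (1 + u y)^d F` vanish for all large `d`, where `u` is a unit,
then `F = 0`. -/
theorem eq_zero_of_coeff_one_add_C_unit_mul_X_pow_mul {R : Type*} [CommRing R] (u : Rˣ)
    (F : R[X]) (c : ℕ) (h : ∀ d, c < d → ((1 + C (u : R) * X) ^ d * F).coeff d = 0) :
    F = 0 := by
  have key := eq_zero_of_forall_sum_choose_smul_eq_zero c (F.natDegree + 1)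
    (fun k => (↑u⁻¹ : R) ^ k * F.coeff k) fun d hd => by
      have := h d hd
      rwa [coeff_one_add_C_unit_mul_X_pow_mul, ← Units.val_pow_eq_pow_val,
        Units.mul_right_eq_zero] at this
  have := key F.natDegree (Nat.lt_succ_self _)
  rwa [← Units.val_pow_eq_pow_val, Units.mul_right_eq_zero, coeff_natDegree,
    leadingCoeff_eq_zero] at this

end Polynomial

/-- Let `A` be a commutative `ℚ`-algebra, `F ∈ A[y]` a polynomial and `c` a
nonnegative integer.  If for every integer `d > c` the coefficient of `y^d` in `(1+4y)^d * F`
vanishes, then `F = 0`. -/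
theorem coeff_one_add_four_y_pow_eq_zero_imp_eq_zero
    (A : Type*) [CommRing A] [Algebra ℚ A] (F : Polynomial A) (c : ℕ)
    (h : ∀ d : ℕ, c < d → ((1 + 4 * Polynomial.X) ^ d * F).coeff d = 0) :
    F = 0 := by
  have hu : IsUnit (4 : A) := by
    rw [← map_ofNat (algebraMap ℚ A) 4]
    exact (IsUnit.mk0 (4 : ℚ) (by norm_num)).map (algebraMap ℚ A)
  obtain ⟨u, hu⟩ := hu
  refine Polynomial.eq_zero_of_coeff_one_add_C_unit_mul_X_pow_mul u F c fun d hd => ?_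
  rw [hu, Polynomial.C_ofNat]
  exact h d hd
end

section
/- The identity A(t)·B(−t) + A(−t)·B(t) + 2 = 0 holds in the formal power series ring ℚ[[t]]. -/
open PowerSeries

/-- The hypergeometric series `A(t) = ∑ (6i)!/((3i)!(2i)!) (t/72)^i ∈ ℚ[[t]]`. -/
noncomputable def seriesA : PowerSeries ℚ :=
  PowerSeries.mk fun i =>
    ((6 * i).factorial : ℚ) / ((3 * i).factorial * (2 * i).factorial) * (1 / 72) ^ i

/-- The hypergeometric series
`B(t) = ∑ (6i)!/((3i)!(2i)!) · (6i+1)/(6i−1) · (t/72)^i ∈ ℚ[[t]]`. -/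
noncomputable def seriesB : PowerSeries ℚ :=
  PowerSeries.mk fun i =>
    ((6 * i).factorial : ℚ) / ((3 * i).factorial * (2 * i).factorial) *
      ((6 * i + 1) / ((6 * i : ℚ) - 1)) * (1 / 72) ^ i

theorem coeff_seriesA_succ (n : ℕ) :
    6 * (n + 1 : ℚ) * coeff (n + 1) seriesA = (6 * n + 5) * (6 * n + 1) * coeff n seriesA := by
  have h6 : 6 * (n + 1) = 6 * n + 5 + 1 := by ring
  have h3 : 3 * (n + 1) = 3 * n + 2 + 1 := by ring
  have h2 : 2 * (n + 1) = 2 * n + 1 + 1 := by ring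
  have f3 : ((3 * n).factorial : ℚ) ≠ 0 := by positivity
  have f2 : ((2 * n).factorial : ℚ) ≠ 0 := by positivity
  simp only [seriesA, coeff_mk, h6, h3, h2, Nat.factorial_succ, pow_succ]
  push_cast
  field_simp
  ring

theorem coeff_seriesB (n : ℕ) :
    (6 * n - 1 : ℚ) * coeff n seriesB = (6 * n + 1) * coeff n seriesA := by
  have h : (6 * n - 1 : ℚ) ≠ 0 := by
    intro h
    have h' : (6 * n - 1 : ℤ) = 0 := by exact_mod_cast h
    omega
  simp only [seriesA, seriesB, coeff_mk]
  field_simp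

theorem coeff_seriesA_add_coeff_seriesB_succ (n : ℕ) :
    coeff (n + 1) seriesA + coeff (n + 1) seriesB = 2 * (6 * n + 1) * coeff n seriesA := by
  have hA := coeff_seriesA_succ n
  have hB := coeff_seriesB (n + 1)
  push_cast at hB
  have h : (6 * n + 5 : ℚ) ≠ 0 := by positivity
  apply mul_left_cancel₀ h
  linear_combination hB + 2 * hA

theorem constantCoeff_seriesA : constantCoeff seriesA = 1 := by
  simp [seriesA, ← coeff_zero_eq_constantCoeff_apply]

theorem constantCoeff_seriesB : constantCoeff seriesB = -1 := by
  simp [seriesB, ← coeff_zero_eq_constantCoeff_apply]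

theorem X_sq_mul_derivative_seriesA :
    12 * X ^ 2 * derivative ℚ seriesA = seriesA + seriesB - 2 * X * seriesA := by
  suffices h : X * (C 12 * (X * derivative ℚ seriesA) + C 2 * seriesA) = seriesA + seriesB by
    simp only [map_ofNat] at h
    linear_combination h
  ext (_ | n)
  · simp [constantCoeff_seriesA, constantCoeff_seriesB]
  · rw [coeff_succ_X_mul, map_add, map_add, coeff_C_mul, coeff_C_mul,
      coeff_seriesA_add_coeff_seriesB_succ]
    cases n with
    | zero => simp
    | succ n =>
      rw [coeff_succ_X_mul, coeff_derivative]
      push_cast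
      ring

theorem X_sq_mul_derivative_seriesB :
    12 * X ^ 2 * derivative ℚ seriesB = seriesA + seriesB + 2 * X * seriesB := by
  suffices h : X * (C 12 * (X * derivative ℚ seriesB) - C 2 * seriesB) = seriesA + seriesB by
    simp only [map_ofNat] at h
    linear_combination h
  ext (_ | n)
  · simp [constantCoeff_seriesA, constantCoeff_seriesB]
  · rw [coeff_succ_X_mul, map_sub, map_add, coeff_C_mul, coeff_C_mul,
      coeff_seriesA_add_coeff_seriesB_succ]
    have hB := coeff_seriesB n
    cases n with
    | zero =>
      simp at hB ⊢
      linarith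
    | succ n =>
      rw [coeff_succ_X_mul, coeff_derivative]
      push_cast at hB ⊢
      linear_combination 2 * hB

theorem derivative_rescale {R : Type*} [CommSemiring R] (a : R) (f : PowerSeries R) :
    derivative R (rescale a f) = C a * rescale a (derivative R f) := by
  ext n
  simp only [coeff_derivative, coeff_rescale, coeff_C_mul]
  ring

/-- The identity `A(t)·B(−t) + A(−t)·B(t) + 2 = 0` holds in `ℚ[[t]]`,
where `F(−t)` denotes the image of `F` under the substitution `t ↦ −t`. -/
theorem seriesA_mul_seriesB_neg_add :
    seriesA * PowerSeries.rescale (-1 : ℚ) seriesB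
      + PowerSeries.rescale (-1 : ℚ) seriesA * seriesB + 2 = 0 := by
  have hA := X_sq_mul_derivative_seriesA
  have hB := X_sq_mul_derivative_seriesB
  have hA' := congrArg (rescale (-1 : ℚ)) hA
  have hB' := congrArg (rescale (-1 : ℚ)) hB
  simp only [map_mul, map_add, map_sub, map_pow, map_ofNat, rescale_X, map_neg, map_one]
    at hA' hB'
  apply derivative.ext
  · have hX : (12 * X ^ 2 : PowerSeries ℚ) ≠ 0 :=
      mul_ne_zero (by exact_mod_cast (map_ne_zero_iff C C_injective).2 (by norm_num : (12 : ℚ) ≠ 0))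
        (pow_ne_zero 2 X_ne_zero)
    apply mul_left_cancel₀ hX
    have h2 : derivative ℚ (2 : PowerSeries ℚ) = 0 :=
      (derivative ℚ).map_natCast 2
    simp only [map_add, map_zero, Derivation.leibniz, derivative_rescale, h2, smul_eq_mul,
      map_neg, map_one]
    linear_combination rescale (-1 : ℚ) seriesB * hA - seriesA * hB' - seriesB * hA'
      + rescale (-1 : ℚ) seriesA * hB
  · simp only [map_add, map_mul, map_zero, ← coeff_zero_eq_constantCoeff_apply, coeff_rescale]
    simp [constantCoeff_seriesA, constantCoeff_seriesB]
    rw [map_ofNat]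
    norm_num
end

section
/- In R_n, the element D_{S,a} does not depend on the choice of the index i ∈ S used in its definition. -/
open MvPolynomial

/-- The generators of the algebra `R_n`: one generator `ψ_i` for each `i ∈ {1,…,n}` and one
generator `D_{ij} = D_{ji}` for each 2-element subset `{i,j} ⊆ {1,…,n}`. -/
abbrev Gen (n : ℕ) : Type := Fin n ⊕ {p : Sym2 (Fin n) // ¬ p.IsDiag}

/-- The polynomial generator corresponding to `ψ_i`. -/
noncomputable def Ppsi {n : ℕ} (i : Fin n) : MvPolynomial (Gen n) ℚ := X (Sum.inl i)

/-- The polynomial generator corresponding to `D_{ij}` (for `i ≠ j`; junk value `0` if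
`i = j`). -/
noncomputable def PD {n : ℕ} (i j : Fin n) : MvPolynomial (Gen n) ℚ :=
  if h : i = j then 0
  else X (Sum.inr ⟨s(i, j), fun hd => h (Sym2.mk_isDiag_iff.mp hd)⟩)

/-- The ideal of relations of `R_n`: `D_{ij}ψ_i = −D_{ij}²` for all `i ≠ j` (which by the
symmetry `D_{ij} = D_{ji}` of the generators also gives `D_{ij}ψ_j = −D_{ij}²`), and
`D_{ij}D_{ik} = D_{ij}D_{jk} = D_{ik}D_{jk}` for pairwise distinct `i, j, k`. -/
noncomputable def relIdeal (n : ℕ) : Ideal (MvPolynomial (Gen n) ℚ) :=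
  Ideal.span
    ({p | ∃ i j : Fin n, i ≠ j ∧ p = PD i j * Ppsi i + PD i j ^ 2} ∪
     {p | ∃ i j k : Fin n, i ≠ j ∧ i ≠ k ∧ j ≠ k ∧
        (p = PD i j * PD i k - PD i j * PD j k ∨
         p = PD i j * PD i k - PD i k * PD j k)})

/-- The commutative `ℚ`-algebra `R_n`, generated by `ψ₁, …, ψ_n` and `D_{ij} = D_{ji}`
subject to the relations `D_{ij}ψ_i = D_{ij}ψ_j = −D_{ij}²` and
`D_{ij}D_{ik} = D_{ij}D_{jk} = D_{ik}D_{jk}` (the universal relations among diagonal and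
cotangent line classes on `M_{g|n}`). -/
abbrev Rring (n : ℕ) : Type := MvPolynomial (Gen n) ℚ ⧸ relIdeal n

/-- The class `ψ_i ∈ R_n`. -/
noncomputable def psiCl {n : ℕ} (i : Fin n) : Rring n :=
  Ideal.Quotient.mk (relIdeal n) (Ppsi i)

/-- The class `D_{ij} ∈ R_n`. -/
noncomputable def DCl {n : ℕ} (i j : Fin n) : Rring n :=
  Ideal.Quotient.mk (relIdeal n) (PD i j)

/-- The class `D_{S,a} ∈ R_n`, relative to a choice of `i ∈ S`:
`D_{S,a} = (−1)^{|S|−1} · (∏_{j ∈ S, j ≠ i} D_{ij}) · ψ_i^{a−|S|+1}`; for `S = {i}` this is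
`ψ_i^a`.  (Meaningful for `i ∈ S` and `a ≥ |S| − 1`.) -/
noncomputable def DSa {n : ℕ} (S : Finset (Fin n)) (a : ℕ) (i : Fin n) : Rring n :=
  (-1) ^ (S.card - 1) * (∏ j ∈ S.erase i, DCl i j) * psiCl i ^ (a + 1 - S.card)

theorem DCl_comm {n : ℕ} (i j : Fin n) : DCl i j = DCl j i := by
  by_cases h : i = j
  · rw [h]
  · simp only [DCl, PD, dif_neg h, dif_neg (Ne.symm h), Sym2.eq_swap]

theorem DCl_mul_psiCl {n : ℕ} {i j : Fin n} (h : i ≠ j) :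
    DCl i j * psiCl i = -DCl i j ^ 2 := by
  rw [eq_neg_iff_add_eq_zero]
  exact Ideal.Quotient.eq_zero_iff_mem.mpr (Ideal.subset_span (Or.inl ⟨i, j, h, rfl⟩))

theorem DCl_mul_psiCl_comm {n : ℕ} {i j : Fin n} (h : i ≠ j) :
    DCl i j * psiCl i = DCl i j * psiCl j := by
  rw [DCl_mul_psiCl h, DCl_comm i j, DCl_mul_psiCl h.symm]

theorem DCl_mul_DCl {n : ℕ} {i j k : Fin n} (hij : i ≠ j) (hik : i ≠ k) (hjk : j ≠ k) :
    DCl i j * DCl i k = DCl i j * DCl j k := by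
  rw [← sub_eq_zero]
  exact Ideal.Quotient.eq_zero_iff_mem.mpr
    (Ideal.subset_span (Or.inr ⟨i, j, k, hij, hik, hjk, Or.inl rfl⟩))

theorem DCl_mul_psiCl_pow {n : ℕ} {i j : Fin n} (h : i ≠ j) (m : ℕ) :
    DCl i j * psiCl i ^ m = DCl i j * psiCl j ^ m := by
  induction m with
  | zero => simp
  | succ m ih =>
    linear_combination psiCl i * ih + psiCl j ^ m * DCl_mul_psiCl_comm h

theorem DCl_mul_prod_DCl {n : ℕ} {i j : Fin n} (h : i ≠ j) (T : Finset (Fin n))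
    (hi : i ∉ T) (hj : j ∉ T) :
    DCl i j * ∏ k ∈ T, DCl i k = DCl i j * ∏ k ∈ T, DCl j k := by
  induction T using Finset.induction_on with
  | empty => simp
  | insert k T hk ih =>
    simp only [Finset.mem_insert, not_or] at hi hj
    rw [Finset.prod_insert hk, Finset.prod_insert hk]
    linear_combination DCl i k * ih hi.2 hj.2 +
      (∏ l ∈ T, DCl j l) * DCl_mul_DCl h hi.1 hj.1

/-- In `R_n` the element `D_{S,a}` does not depend on the choice of the
index `i ∈ S` used in its definition. -/
theorem DSa_independent_of_choice {n : ℕ} (S : Finset (Fin n)) (a : ℕ)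
    (ha : S.card - 1 ≤ a) (i i' : Fin n) (hi : i ∈ S) (hi' : i' ∈ S) :
    DSa S a i = DSa S a i' := by
  by_cases h : i = i'
  · rw [h]
  have hprod := DCl_mul_prod_DCl h ((S.erase i).erase i') (by simp) (by simp)
  have hpow := DCl_mul_psiCl_pow h (a + 1 - S.card)
  unfold DSa
  rw [← Finset.mul_prod_erase (S.erase i) _ (Finset.mem_erase.mpr ⟨Ne.symm h, hi'⟩),
    ← Finset.mul_prod_erase (S.erase i') _ (Finset.mem_erase.mpr ⟨h, hi⟩),
    Finset.erase_right_comm (a := i') (b := i), DCl_comm i' i]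
  linear_combination (-1) ^ (S.card - 1) * psiCl i ^ (a + 1 - S.card) * hprod +
    (-1) ^ (S.card - 1) * (∏ k ∈ (S.erase i).erase i', DCl i' k) * hpow
end
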